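/- Assume the Setting. Then for every x ∈ L and every y ∈ L with y ≠ x such that C_y = p + C_x for some p ∈ ℝ^n, the set Λ = C_x ∩ C_y is the image of a topological embedding of the sphere S^{n−2} into ℝ^n. -/

import Mathlib

open Set Metric RealInnerProductSpace

noncomputable section

/-- Euclidean space ℝ^n. -/
abbrev Euc (n : ℕ) := EuclideanSpace ℝ (Fin n)

/-- The solid double-cone generated by a convex body `K` and a point `x`:
the union of all lines through `x` and a point of `K`. -/
def solidCone {n : ℕ} (K : Set (Euc n)) (x : Euc n) : Set (Euc n) :=
  ⋃ y ∈ K, (affineSpan ℝ ({x, y} : Set (Euc n)) : Set (Euc n))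

/-- The support double-cone of `K` with apex `x`: the topological frontier of
the solid double-cone. -/
def supportCone {n : ℕ} (K : Set (Euc n)) (x : Euc n) : Set (Euc n) :=
  frontier (solidCone K x)

/-- A convex body: a compact convex set with nonempty interior. -/
def IsConvexBody {n : ℕ} (K : Set (Euc n)) : Prop :=
  IsCompact K ∧ Convex ℝ K ∧ (interior K).Nonempty

/-- `M` is the image of a topological embedding of the sphere `S^m ⊆ ℝ^(m+1)`
into ℝ^n: a continuous injective map from the unit sphere with range `M`
(such a map from the compact sphere is automatically a homeomorphism onto its
image). -/
def IsSphereEmbeddingImage {n : ℕ} (m : ℕ) (M : Set (Euc n)) : Prop :=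
  ∃ f : Metric.sphere (0 : Euc (m + 1)) 1 → Euc n,
    Continuous f ∧ Function.Injective f ∧ Set.range f = M

/-- Closed pointed convex cone with interior point `v`. -/
structure GoodCone {n : ℕ} (D : Set (Euc n)) (v : Euc n) : Prop where
  closed : IsClosed D
  add : ∀ a ∈ D, ∀ b ∈ D, a + b ∈ D
  smul : ∀ c : ℝ, 0 ≤ c → ∀ a ∈ D, c • a ∈ D
  pointed : ∀ a ∈ D, -a ∈ D → a = 0
  int : v ∈ interior D

/-- The height function of the cone `D` in direction `v`. -/
def phi {n : ℕ} (D : Set (Euc n)) (v z : Euc n) : ℝ := sInf {a : ℝ | z + a • v ∈ D}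

lemma nontriv_euc {n : ℕ} (hn : 3 ≤ n) : Nontrivial (Euc n) := by
  apply Module.nontrivial_of_finrank_pos (R := ℝ)
  rw [finrank_euclideanSpace, Fintype.card_fin]; omega

lemma exists_small {n : ℕ} {D : Set (Euc n)} {v : Euc n} (h : v ∈ interior D) (z : Euc n) :
    ∃ ε : ℝ, 0 < ε ∧ v + ε • z ∈ D ∧ v + ε • (-z) ∈ D := by
  have h1 : D ∈ nhds v := mem_interior_iff_mem_nhds.1 h
  have key : ∀ z : Euc n, ∀ᶠ ε : ℝ in nhdsWithin 0 (Ioi 0), v + ε • z ∈ D := by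
    intro z
    have hc : Filter.Tendsto (fun ε : ℝ => v + ε • z) (nhds 0) (nhds v) := by
      have : Continuous (fun ε : ℝ => v + ε • z) := by fun_prop
      simpa using this.tendsto 0
    exact (hc.eventually h1).filter_mono nhdsWithin_le_nhds
  obtain ⟨ε, ⟨ha, hb⟩, hc⟩ := (((key z).and (key (-z))).and self_mem_nhdsWithin).exists
  exact ⟨ε, hc, ha, hb⟩

namespace GoodCone

variable {n : ℕ} {D : Set (Euc n)} {v : Euc n}

lemma v_mem (h : GoodCone D v) : v ∈ D := interior_subset h.int

lemma zero_mem (h : GoodCone D v) : (0 : Euc n) ∈ D := by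
  simpa using h.smul 0 le_rfl v h.v_mem

lemma v_ne (h : GoodCone D v) (hn : 3 ≤ n) : v ≠ 0 := by
  intro h0
  have := nontriv_euc hn
  obtain ⟨z, hz⟩ := exists_ne (0 : Euc n)
  obtain ⟨ε, he, h1, h2⟩ := exists_small h.int z
  have := h.pointed (ε • z) (by simpa [h0] using h1) (by simpa [h0] using h2)
  rcases smul_eq_zero.1 this with h | h
  · exact he.ne' h
  · exact hz h

lemma limit_mem (h : GoodCone D v) {a q : Euc n} (H : ∀ t : ℝ, 0 < t → a + t • q ∈ D) : q ∈ D := by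
  have hc : Filter.Tendsto (fun ε : ℝ => q + ε • a) (nhdsWithin 0 (Ioi 0)) (nhds q) := by
    have : Continuous (fun ε : ℝ => q + ε • a) := by fun_prop
    have := this.tendsto 0
    simp only [zero_smul, add_zero] at this
    exact this.mono_left nhdsWithin_le_nhds
  refine h.closed.mem_of_tendsto hc ?_
  filter_upwards [self_mem_nhdsWithin] with ε he
  have he : 0 < ε := he
  have := h.smul ε he.le _ (H ε⁻¹ (inv_pos.2 he))
  rw [smul_add, smul_smul, mul_inv_cancel₀ he.ne', one_smul, add_comm] at this
  exact this

lemma up (h : GoodCone D v) {z : Euc n} {a b : ℝ} (ha : z + a • v ∈ D) (hab : a ≤ b) :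
    z + b • v ∈ D := by
  have := h.add _ ha _ (h.smul (b - a) (by linarith) v h.v_mem)
  convert this using 1
  module

lemma phi_set_nonempty (h : GoodCone D v) (z : Euc n) : {a : ℝ | z + a • v ∈ D}.Nonempty := by
  obtain ⟨ε, he, h1, -⟩ := exists_small h.int z
  refine ⟨ε⁻¹, ?_⟩
  have := h.smul ε⁻¹ (inv_pos.2 he).le _ h1
  rw [smul_add, smul_smul, inv_mul_cancel₀ he.ne', one_smul, add_comm] at this
  exact this

lemma phi_set_bdd (h : GoodCone D v) (hn : 3 ≤ n) (z : Euc n) :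
    BddBelow {a : ℝ | z + a • v ∈ D} := by
  by_contra hb
  rw [not_bddBelow_iff] at hb
  have : -v ∈ D := by
    apply h.limit_mem (a := z)
    intro t ht
    obtain ⟨a, ha, hat⟩ := hb (-t)
    have := h.up ha hat.le
    convert this using 1
    module
  exact h.v_ne hn (h.pointed v h.v_mem this)

lemma phi_le_iff (h : GoodCone D v) (hn : 3 ≤ n) (z : Euc n) (a : ℝ) :
    phi D v z ≤ a ↔ z + a • v ∈ D := by
  constructor
  · intro ha
    have hcl : IsClosed {a : ℝ | z + a • v ∈ D} :=
      h.closed.preimage (f := fun a : ℝ => z + a • v) (by fun_prop)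
    have := hcl.csInf_mem (h.phi_set_nonempty z) (h.phi_set_bdd hn z)
    exact h.up this ha
  · intro ha
    exact csInf_le (h.phi_set_bdd hn z) ha

lemma mem_iff (h : GoodCone D v) (hn : 3 ≤ n) (z : Euc n) : z ∈ D ↔ phi D v z ≤ 0 := by
  rw [h.phi_le_iff hn]; simp

lemma phi_mem (h : GoodCone D v) (hn : 3 ≤ n) (z : Euc n) : z + phi D v z • v ∈ D :=
  (h.phi_le_iff hn _ _).1 le_rfl

lemma phi_add (h : GoodCone D v) (hn : 3 ≤ n) (z w : Euc n) :
    phi D v (z + w) ≤ phi D v z + phi D v w := by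
  rw [h.phi_le_iff hn]
  convert h.add _ (h.phi_mem hn z) _ (h.phi_mem hn w) using 1
  module

lemma phi_shift (h : GoodCone D v) (hn : 3 ≤ n) (z : Euc n) (t : ℝ) :
    phi D v (z + t • v) = phi D v z - t := by
  apply eq_of_forall_ge_iff
  intro c
  rw [h.phi_le_iff hn, sub_le_iff_le_add, h.phi_le_iff hn]
  have : z + t • v + c • v = z + (c + t) • v := by module
  rw [this]

lemma phi_smul_pos (h : GoodCone D v) (hn : 3 ≤ n) (z : Euc n) {c : ℝ} (hc : 0 < c) :
    phi D v (c • z) = c * phi D v z := by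
  have key : ∀ (z : Euc n) (c : ℝ), 0 < c → phi D v (c • z) ≤ c * phi D v z := by
    intro z c hc
    rw [h.phi_le_iff hn]
    convert h.smul c hc.le _ (h.phi_mem hn z) using 1
    module
  refine le_antisymm (key z c hc) ?_
  have := key (c • z) c⁻¹ (inv_pos.2 hc)
  rw [smul_smul, inv_mul_cancel₀ hc.ne', one_smul] at this
  calc c * phi D v z ≤ c * (c⁻¹ * phi D v (c • z)) := by gcongr
    _ = _ := by field_simp

lemma phi_zero (h : GoodCone D v) (hn : 3 ≤ n) : phi D v 0 = 0 := by
  have := h.phi_smul_pos hn 0 (c := 2) (by norm_num)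
  simp at this; linarith

lemma phi_smul (h : GoodCone D v) (hn : 3 ≤ n) (z : Euc n) {c : ℝ} (hc : 0 ≤ c) :
    phi D v (c • z) = c * phi D v z := by
  rcases hc.eq_or_lt with rfl | hc
  · simp [h.phi_zero hn]
  · exact h.phi_smul_pos hn z hc

lemma phi_cont (h : GoodCone D v) (hn : 3 ≤ n) : Continuous (phi D v) := by
  have : ConvexOn ℝ univ (phi D v) := by
    refine ⟨convex_univ, ?_⟩
    intro x _ y _ a b ha hb _
    rw [smul_eq_mul, smul_eq_mul, ← h.phi_smul hn x ha, ← h.phi_smul hn y hb]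
    exact h.phi_add hn _ _
  exact this.locallyLipschitz.continuous

lemma eq_of_phi (h : GoodCone D v) (hn : 3 ≤ n) {z : Euc n} (hz : phi D v z + phi D v (-z) ≤ 0) :
    z + phi D v z • v = 0 := by
  apply h.pointed _ (h.phi_mem hn z)
  have : phi D v (-z) ≤ - phi D v z := by linarith
  rw [h.phi_le_iff hn] at this
  convert this using 1
  module

lemma eq_zero_of_phi (h : GoodCone D v) (hn : 3 ≤ n) {z : Euc n} (hz : phi D v z ≤ 0)
    (hz' : phi D v (-z) ≤ 0) : z = 0 :=
  h.pointed z ((h.mem_iff hn _).2 hz) ((h.mem_iff hn _).2 hz')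

lemma phi_bdry (h : GoodCone D v) (hn : 3 ≤ n) (z : Euc n) :
    phi D v (z + phi D v z • v) = 0 := by
  rw [h.phi_shift hn]; ring

lemma int_phi (h : GoodCone D v) (hn : 3 ≤ n) {z : Euc n} (hz : z ∈ interior D) :
    phi D v z < 0 := by
  obtain ⟨ε, he, -, h2⟩ := exists_small hz v
  have : phi D v z ≤ -ε := by
    rw [h.phi_le_iff hn]
    convert h2 using 1
    module
  linarith

lemma phi_sum_pos (h : GoodCone D v) (hn : 3 ≤ n) {z : Euc n} (hz : z ∉ Submodule.span ℝ {v}) :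
    0 < phi D v z + phi D v (-z) := by
  by_contra hc
  push Not at hc
  have := h.eq_of_phi hn hc
  apply hz
  rw [Submodule.mem_span_singleton]
  exact ⟨-phi D v z, by rw [neg_smul]; exact (eq_neg_of_add_eq_zero_left this).symm⟩

lemma exists_not_span {n : ℕ} (hn : 3 ≤ n) (v q : Euc n) :
    ∃ z : Euc n, z ∉ Submodule.span ℝ {v, q} := by
  by_contra hc
  push Not at hc
  have h1 : Submodule.span ℝ {v, q} = ⊤ := by
    rw [eq_top_iff]; intro z _; exact hc z
  have h2 := finrank_span_finset_le_card (R := ℝ) ({v, q} : Finset (Euc n))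
  rw [Set.finrank, Finset.coe_pair, h1, finrank_top, finrank_euclideanSpace, Fintype.card_fin] at h2
  have := Finset.card_le_two (a := v) (b := q)
  omega

/-- boundary of the double cone -/
lemma frontier_eq (h : GoodCone D v) (hn : 3 ≤ n) :
    frontier {z | z ∈ D ∨ -z ∈ D} = {z | phi D v z = 0 ∨ phi D v (-z) = 0} := by
  have hcont := h.phi_cont hn
  have hcont' : Continuous fun z => phi D v (-z) := hcont.comp continuous_neg
  have hS : {z | z ∈ D ∨ -z ∈ D} = {z | phi D v z ≤ 0 ∨ phi D v (-z) ≤ 0} := by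
    ext z; simp only [mem_ofPred_eq, h.mem_iff hn]
  have hcl : IsClosed {z | z ∈ D ∨ -z ∈ D} :=
    h.closed.union (h.closed.preimage continuous_neg)
  have hop : IsOpen {z | phi D v z < 0 ∨ phi D v (-z) < 0} :=
    (isOpen_lt hcont continuous_const).union (isOpen_lt hcont' continuous_const)
  obtain ⟨w, hw⟩ := exists_not_span hn v v
  have hw0 := h.phi_sum_pos hn (z := w) (by simpa using hw)
  -- curve criterion
  have curve : ∀ z u : Euc n, ∀ δ : ℝ, 0 < δ →
      (∀ ε, 0 < ε → ε < δ → 0 < phi D v (z + ε • u) ∧ 0 < phi D v (-(z + ε • u))) →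
      z ∉ interior {z | z ∈ D ∨ -z ∈ D} := by
    intro z u δ hδ H hz
    have hc : Filter.Tendsto (fun ε : ℝ => z + ε • u) (nhds 0) (nhds z) := by
      have : Continuous (fun ε : ℝ => z + ε • u) := by fun_prop
      simpa using this.tendsto 0
    have h1 := (hc.eventually (mem_interior_iff_mem_nhds.1 hz)).filter_mono
      (nhdsWithin_le_nhds (s := Ioi 0))
    obtain ⟨ε, ha, hb⟩ := (h1.and (Ioo_mem_nhdsGT hδ)).exists
    rw [h.mem_iff hn, h.mem_iff hn] at ha
    have := H ε hb.1 hb.2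
    rcases ha with ha | ha <;> linarith
  have zero_case : (0 : Euc n) ∉ interior {z | z ∈ D ∨ -z ∈ D} := by
    apply curve 0 (w + ((phi D v w - phi D v (-w)) / 2) • v) 1 one_pos
    intro ε he _
    rw [zero_add, ← smul_neg, h.phi_smul hn _ he.le, h.phi_smul hn _ he.le, h.phi_shift hn]
    have : -(w + ((phi D v w - phi D v (-w)) / 2) • v)
      = -w + (-((phi D v w - phi D v (-w)) / 2)) • v := by module
    rw [this, h.phi_shift hn]
    constructor <;> apply mul_pos he <;> linarith
  have main_case : ∀ z, phi D v z = 0 → z ∉ interior {z | z ∈ D ∨ -z ∈ D} := by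
    intro z hz
    by_cases h0 : z = 0
    · rw [h0]; exact zero_case
    have hp : 0 < phi D v (-z) := by
      by_contra hc
      exact h0 (h.eq_zero_of_phi hn hz.le (not_lt.1 hc))
    apply curve z (-v) _ hp
    intro ε he hlt
    have e1 : z + ε • (-v) = z + (-ε) • v := by module
    have e2 : -(z + ε • (-v)) = -z + ε • v := by module
    rw [e2, e1, h.phi_shift hn, h.phi_shift hn]
    constructor <;> linarith
  have hneg : ∀ z, z ∈ interior {z | z ∈ D ∨ -z ∈ D} → -z ∈ interior {z | z ∈ D ∨ -z ∈ D} := by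
    intro z hz
    have h1 : -z ∈ (Homeomorph.neg (Euc n)) '' interior {z | z ∈ D ∨ -z ∈ D} := ⟨z, hz, rfl⟩
    rw [Homeomorph.image_interior] at h1
    convert h1 using 2
    ext y
    simp [or_comm]
  rw [hcl.frontier_eq]
  ext z
  constructor
  · rintro ⟨h1, h2⟩
    have h3 : ¬ (phi D v z < 0 ∨ phi D v (-z) < 0) := by
      intro hc
      apply h2
      refine (interior_maximal ?_ hop) hc
      rw [hS]
      rintro y (hy | hy)
      exacts [Or.inl hy.le, Or.inr hy.le]
    push Not at h3
    rw [hS] at h1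
    rcases h1 with h1 | h1
    · exact Or.inl (le_antisymm h1 h3.1)
    · exact Or.inr (le_antisymm h1 h3.2)
  · rintro (hz | hz)
    · exact ⟨by rw [hS]; exact Or.inl hz.le, main_case z hz⟩
    · exact ⟨by rw [hS]; exact Or.inr hz.le, fun hc => main_case (-z) hz (hneg z hc)⟩

end GoodCone

namespace GoodCone

variable {n : ℕ} {D D' : Set (Euc n)} {v v' : Euc n}

lemma line_aux (h : GoodCone D v) {q a : Euc n} (hq : q ≠ 0)
    (H : ∀ s : ℝ, a + s • q ∈ D ∨ -(a + s • q) ∈ D) : ∃ s : ℝ, a + s • q = 0 := by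
  by_contra hne
  push Not at hne
  have hc : Continuous (fun s : ℝ => a + s • q) := by fun_prop
  have c1 : IsClosed ((fun s : ℝ => a + s • q) ⁻¹' D) := h.closed.preimage hc
  have c2 : IsClosed ((fun s : ℝ => -(a + s • q)) ⁻¹' D) := h.closed.preimage hc.neg
  have := isPreconnected_iff_subset_of_disjoint_closed.1 (isPreconnected_univ (α := ℝ)) _ _ c1 c2
    (fun s _ => H s) (by
      ext s
      simp only [mem_inter_iff, mem_univ, true_and, mem_preimage, mem_empty_iff_false, iff_false]
      rintro ⟨h1, h2⟩
      exact hne s (h.pointed _ h1 h2))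
  rcases this with h1 | h1
  · refine hq (h.pointed q ?_ ?_)
    · exact h.limit_mem (a := a) fun t _ => h1 (mem_univ t)
    · refine h.limit_mem (a := a) fun t _ => ?_
      have : a + (-t) • q ∈ D := h1 (mem_univ (-t))
      convert this using 1
      module
  · refine hq (h.pointed q ?_ ?_)
    · refine h.limit_mem (a := -a) fun t _ => ?_
      have : -(a + (-t) • q) ∈ D := h1 (mem_univ (-t))
      convert this using 1
      module
    · refine h.limit_mem (a := -a) fun t _ => ?_
      have : -(a + t • q) ∈ D := h1 (mem_univ t)
      convert this using 1
      module

/-- boundary double cone -/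
def bd {n : ℕ} (D : Set (Euc n)) (v : Euc n) : Set (Euc n) :=
  {z | phi D v z = 0 ∨ phi D v (-z) = 0}

lemma bd_smul (h : GoodCone D v) (hn : 3 ≤ n) {z : Euc n} (hz : z ∈ bd D v) (t : ℝ) :
    t • z ∈ bd D v := by
  rcases le_total 0 t with ht | ht
  · rcases hz with hz | hz
    · left; rw [h.phi_smul hn _ ht, hz, mul_zero]
    · right; rw [← smul_neg, h.phi_smul hn _ ht, hz, mul_zero]
  · have e : t • z = (-t) • (-z) := by module
    have e' : - (t • z) = (-t) • z := by module
    rcases hz with hz | hz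
    · right; rw [e', h.phi_smul hn _ (by linarith), hz, mul_zero]
    · left; rw [e, h.phi_smul hn _ (by linarith), hz, mul_zero]

lemma bd_mem (h : GoodCone D v) (hn : 3 ≤ n) {z : Euc n} (hz : z ∈ bd D v) : z ∈ D ∨ -z ∈ D := by
  rcases hz with hz | hz
  · left; rw [h.mem_iff hn]; exact hz.le
  · right; rw [h.mem_iff hn]; exact hz.le

lemma apex (h : GoodCone D v) (h' : GoodCone D' v') (hn : 3 ≤ n) {q : Euc n}
    (H : ∀ z, z ∈ bd D' v' ↔ z - q ∈ bd D v) : q = 0 := by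
  by_contra hq
  have step : ∀ a ∈ bd D v, ∀ s : ℝ, s ≠ 1 → a + s • q ∈ bd D v := by
    intro a ha s hs
    have hs' : 1 - s ≠ 0 := sub_ne_zero.2 hs.symm
    have h1 : a + q ∈ bd D' v' := (H _).2 (by simpa using ha)
    have h2 := (H _).1 (h'.bd_smul hn h1 (1 - s)⁻¹)
    have h3 := h.bd_smul hn h2 (1 - s)
    rw [smul_sub, smul_smul, mul_inv_cancel₀ hs', one_smul] at h3
    convert h3 using 1
    module
  have all : ∀ a ∈ bd D v, ∀ s : ℝ, a + s • q ∈ bd D v := by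
    intro a ha s
    by_cases hs : s = 1
    · have := step _ (step a ha (1/2) (by norm_num)) (1/2) (by norm_num)
      convert this using 1
      rw [hs]; module
    · exact step a ha s hs
  obtain ⟨z, hz⟩ := exists_not_span hn v q
  have hb : z + phi D v z • v ∈ bd D v := Or.inl (h.phi_bdry hn z)
  obtain ⟨s, hs⟩ := h.line_aux hq (fun s => h.bd_mem hn (all _ hb s))
  apply hz
  rw [Submodule.mem_span_pair]
  refine ⟨-phi D v z, -s, ?_⟩
  have : z = (-phi D v z) • v + (-s) • q + (z + phi D v z • v + s • q) := by module
  rw [hs, add_zero] at this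
  exact this.symm

lemma subset_aux (h : GoodCone D v) (h' : GoodCone D' v') (hn : 3 ≤ n)
    (H : ∀ z, phi D v z = 0 → z ∈ D') : D ⊆ D' := by
  obtain ⟨w, hw⟩ := exists_not_span hn v v
  have hw0 := h.phi_sum_pos hn (z := w) (by simpa using hw)
  have hv : v ∈ D' := by
    have h1 := h'.add _ (H _ (h.phi_bdry hn w)) _ (H _ (h.phi_bdry hn (-w)))
    have h2 := h'.smul (phi D v w + phi D v (-w))⁻¹ (inv_pos.2 hw0).le _ h1
    have e : w + phi D v w • v + (-w + phi D v (-w) • v) = (phi D v w + phi D v (-w)) • v := by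
      module
    rw [e, smul_smul, inv_mul_cancel₀ hw0.ne', one_smul] at h2
    exact h2
  intro z hz
  have h1 := h'.add _ (H _ (h.phi_bdry hn z)) _
    (h'.smul (-phi D v z) (by have := (h.mem_iff hn z).1 hz; linarith) v hv)
  convert h1 using 1
  module

lemma neg (h : GoodCone D v) : GoodCone {z | -z ∈ D} (-v) where
  closed := h.closed.preimage continuous_neg
  add a ha b hb := by
    have := h.add _ ha _ hb
    change -(a + b) ∈ D
    rwa [neg_add]
  smul c hc a ha := by
    have := h.smul c hc _ ha
    change -(c • a) ∈ D
    rwa [← smul_neg]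
  pointed a ha hb := by
    have := h.pointed (-a) ha hb
    simpa using this
  int := by
    have h1 : -v ∈ (Homeomorph.neg (Euc n)) '' interior D := ⟨v, h.int, rfl⟩
    rw [Homeomorph.image_interior] at h1
    convert h1 using 2
    ext y
    simp

lemma subset_or (h : GoodCone D v) (h' : GoodCone D' v') (hn : 3 ≤ n)
    (H : ∀ z, phi D v z = 0 → z ∈ D' ∨ -z ∈ D') : D ⊆ D' ∨ ∀ z ∈ D, -z ∈ D' := by
  have hrank : 1 < Module.rank ℝ (Euc n ⧸ Submodule.span ℝ {v}) := by
    rw [← Module.finrank_eq_rank]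
    have h1 := Submodule.finrank_quotient_add_finrank (Submodule.span ℝ {v})
    rw [finrank_euclideanSpace, Fintype.card_fin, finrank_span_singleton (h.v_ne hn)] at h1
    have : 1 < Module.finrank ℝ (Euc n ⧸ Submodule.span ℝ {v}) := by omega
    exact_mod_cast this
  have hconn := (isConnected_compl_of_one_lt_codim hrank).isPreconnected
  have hcont : Continuous (fun z => z + phi D v z • v) := by
    have := h.phi_cont hn
    fun_prop
  have hpre := hconn.image _ hcont.continuousOn
  have := isPreconnected_iff_subset_of_disjoint_closed.1 hpre D' {z | -z ∈ D'} h'.closed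
    (h'.closed.preimage continuous_neg)
    (by
      rintro _ ⟨z, hz, rfl⟩
      exact H _ (h.phi_bdry hn z))
    (by
      rw [eq_empty_iff_forall_notMem]
      rintro _ ⟨⟨z, hz, rfl⟩, h1, h2⟩
      have h0 := h'.pointed _ h1 h2
      apply hz
      refine Submodule.mem_span_singleton.2 ⟨-phi D v z, ?_⟩
      rw [neg_smul]; exact (eq_neg_of_add_eq_zero_left h0).symm)
  have ext : ∀ {D' : Set (Euc n)} {v' : Euc n}, GoodCone D' v' →
      ((fun z => z + phi D v z • v) '' (Submodule.span ℝ {v} : Set (Euc n))ᶜ ⊆ D') → D ⊆ D' := by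
    intro D' v' h' hs
    apply h.subset_aux h' hn
    intro z hz
    by_cases hzs : z ∈ Submodule.span ℝ {v}
    · obtain ⟨c, rfl⟩ := Submodule.mem_span_singleton.1 hzs
      have h1 := h.phi_shift hn 0 c
      rw [zero_add, hz, h.phi_zero hn] at h1
      have : c = 0 := by linarith
      rw [this, zero_smul]; exact h'.zero_mem
    · exact hs ⟨z, hzs, by simp [hz]⟩
  rcases this with h1 | h1
  · exact Or.inl (ext h' h1)
  · exact Or.inr (ext h'.neg h1)

lemma eq_or_neg (h : GoodCone D v) (h' : GoodCone D' v') (hn : 3 ≤ n)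
    (H : bd D v = bd D' v') : D = D' ∨ D' = {z | -z ∈ D} := by
  have h1 := h.subset_or h' hn (fun z hz => h'.bd_mem hn (H ▸ (Or.inl hz : z ∈ bd D v)))
  have h2 := h'.subset_or h hn (fun z hz => h.bd_mem hn (H ▸ (Or.inl hz : z ∈ bd D' v')))
  rcases h1 with h1 | h1 <;> rcases h2 with h2 | h2
  · exact Or.inl (h1.antisymm h2)
  · exact absurd (h.pointed v h.v_mem (h2 _ (h1 h.v_mem))) (h.v_ne hn)
  · exact absurd (h.pointed v h.v_mem (h2 (h1 _ h.v_mem))) (h.v_ne hn)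
  · right
    ext z
    refine ⟨fun hz => h2 z hz, fun hz => ?_⟩
    simpa using h1 _ hz

end GoodCone

/-- The convex cone generated by `K - x`. -/
def kcone {n : ℕ} (K : Set (Euc n)) (x : Euc n) : Set (Euc n) :=
  {z | ∃ s : ℝ, 0 ≤ s ∧ ∃ k ∈ K, z = s • (k - x)}

lemma kcone_good {n : ℕ} {K : Set (Euc n)} {x k₀ : Euc n} (hK : IsConvexBody K) (hx : x ∉ K)
    (hk₀ : k₀ ∈ interior K) : GoodCone (kcone K x) (k₀ - x) where
  closed := by
    obtain ⟨hc, -, -⟩ := hK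
    obtain ⟨c, hc0, hcK⟩ : ∃ c > 0, ∀ k ∈ K, c ≤ ‖k - x‖ := by
      have := hc.isClosed.isOpen_compl.mem_nhds (show x ∈ Kᶜ from hx)
      obtain ⟨c, hc0, hb⟩ := Metric.mem_nhds_iff.1 this
      refine ⟨c, hc0, fun k hk => ?_⟩
      by_contra hlt
      exact hb (by rw [mem_ball, dist_eq_norm]; exact not_le.1 hlt) hk
    apply isClosed_of_closure_subset
    intro z hz
    set M := (‖z‖ + 1) / c
    have hcomp : IsCompact ((fun p : ℝ × Euc n => p.1 • (p.2 - x)) '' (Icc 0 M ×ˢ K)) :=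
      (isCompact_Icc.prod hc).image (by fun_prop)
    have hz2 : z ∈ closure (ball z 1 ∩ kcone K x) :=
      isOpen_ball.inter_closure ⟨mem_ball_self one_pos, hz⟩
    have hsub : ball z 1 ∩ kcone K x ⊆
        (fun p : ℝ × Euc n => p.1 • (p.2 - x)) '' (Icc 0 M ×ˢ K) := by
      rintro _ ⟨hb, s, hs, k, hk, rfl⟩
      refine ⟨(s, k), ⟨⟨hs, ?_⟩, hk⟩, rfl⟩
      rw [mem_ball, dist_eq_norm] at hb
      have h1 : ‖s • (k - x)‖ ≤ ‖z‖ + 1 := by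
        have := norm_le_norm_add_norm_sub' (s • (k - x)) z
        linarith
      rw [norm_smul, Real.norm_of_nonneg hs] at h1
      rw [le_div_iff₀ hc0]
      have := mul_le_mul_of_nonneg_left (hcK k hk) hs
      linarith
    obtain ⟨⟨s, k⟩, ⟨hs, hk⟩, rfl⟩ := closure_minimal hsub hcomp.isClosed hz2
    exact ⟨s, hs.1, k, hk, rfl⟩
  add := by
    rintro _ ⟨s, hs, k, hk, rfl⟩ _ ⟨t, ht, l, hl, rfl⟩
    by_cases h0 : s + t = 0
    · have : s = 0 := by linarith
      have : t = 0 := by linarith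
      exact ⟨0, le_rfl, k, hk, by simp [*]⟩
    · have hp : 0 < s + t := lt_of_le_of_ne (by linarith) (Ne.symm h0)
      refine ⟨s + t, hp.le, (s / (s + t)) • k + (t / (s + t)) • l,
        hK.2.1 hk hl (by positivity) (by positivity) (by field_simp), ?_⟩
      rw [smul_sub (s + t), smul_add, smul_smul, smul_smul, mul_div_cancel₀ _ h0,
        mul_div_cancel₀ _ h0]
      module
  smul := by
    rintro c hc _ ⟨s, hs, k, hk, rfl⟩
    exact ⟨c * s, by positivity, k, hk, by rw [smul_smul]⟩
  pointed := by
    rintro _ ⟨s, hs, k, hk, rfl⟩ ⟨t, ht, l, hl, h⟩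
    by_cases h0 : s + t = 0
    · have : s = 0 := by linarith
      simp [this]
    · exfalso
      have hp : 0 < s + t := lt_of_le_of_ne (by linarith) (Ne.symm h0)
      apply hx
      have e : x = (s / (s + t)) • k + (t / (s + t)) • l := by
        have h1 : (s + t) • x = s • k + t • l := by
          have : s • k + t • l - (s + t) • x = s • (k - x) + t • (l - x) := by module
          rw [← h, add_neg_cancel, sub_eq_zero] at this
          exact this.symm
        have h2 := congrArg ((s + t)⁻¹ • ·) h1
        simp only [smul_smul, smul_add, inv_mul_cancel₀ h0, one_smul] at h2
        rw [h2, div_eq_inv_mul, div_eq_inv_mul]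
      rw [e]
      exact hK.2.1 hk hl (by positivity) (by positivity) (by field_simp)
  int := by
    have h1 : k₀ - x ∈ (Homeomorph.subRight x) '' interior K := ⟨k₀, hk₀, rfl⟩
    rw [Homeomorph.image_interior] at h1
    refine interior_mono ?_ h1
    rintro _ ⟨k, hk, rfl⟩
    exact ⟨1, zero_le_one, k, hk, by simp⟩

lemma mem_solidCone {n : ℕ} {K : Set (Euc n)} {x z : Euc n} :
    z ∈ solidCone K x ↔ z - x ∈ kcone K x ∨ -(z - x) ∈ kcone K x := by
  simp only [solidCone, mem_iUnion, SetLike.mem_coe, mem_affineSpan_pair_iff_exists_lineMap_eq,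
    AffineMap.lineMap_apply_module', exists_prop]
  constructor
  · rintro ⟨k, hk, r, rfl⟩
    rcases le_total 0 r with hr | hr
    · exact Or.inl ⟨r, hr, k, hk, by module⟩
    · exact Or.inr ⟨-r, by linarith, k, hk, by module⟩
  · rintro (⟨s, hs, k, hk, h⟩ | ⟨s, hs, k, hk, h⟩)
    · exact ⟨k, hk, s, by rw [← h]; module⟩
    · exact ⟨k, hk, -s, by rw [neg_smul, ← h]; module⟩

lemma mem_supportCone {n : ℕ} (hn : 3 ≤ n) {K : Set (Euc n)} {x v : Euc n}
    (h : GoodCone (kcone K x) v) (z : Euc n) :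
    z ∈ supportCone K x ↔ z - x ∈ GoodCone.bd (kcone K x) v := by
  have h1 : solidCone K x =
      (Homeomorph.subRight x) ⁻¹' {z | z ∈ kcone K x ∨ -z ∈ kcone K x} := by
    ext z; exact mem_solidCone
  rw [supportCone, h1, ← Homeomorph.preimage_frontier, h.frontier_eq hn]
  rfl

/-- The two cones cannot coincide. -/
lemma same_cone_aux {n : ℕ} (hn : 3 ≤ n) {K : Set (Euc n)} {x y v : Euc n}
    (h : GoodCone (kcone K x) v) (heq : kcone K x = kcone K y) :
    phi (kcone K x) v (-(y - x)) ≤ 0 := by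
  by_contra hc
  push Not at hc
  set D := kcone K x with hD
  set e := y - x with he
  -- every nonzero boundary vector, suitably scaled, lies in `e + D`
  have key : ∀ b, phi D v b = 0 → b ≠ 0 → ∃ s : ℝ, 0 ≤ s ∧ s • b - e ∈ D := by
    intro b hb hb0
    have hbD : b ∈ D := (h.mem_iff hn b).2 hb.le
    obtain ⟨s, hs, k, hk, hbk⟩ := hbD
    have hs0 : s ≠ 0 := by rintro rfl; exact hb0 (by simpa using hbk)
    refine ⟨s⁻¹, inv_nonneg.2 hs, ?_⟩
    rw [hbk, smul_smul, inv_mul_cancel₀ hs0, one_smul, heq]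
    exact ⟨1, zero_le_one, k, hk, by rw [he]; module⟩
  by_cases hb : -e + phi D v (-e) • v = 0
  · obtain ⟨w, hw⟩ := GoodCone.exists_not_span hn v v
    have hb' : w + phi D v w • v ≠ 0 := by
      intro h0
      apply hw
      rw [Submodule.mem_span_pair]
      exact ⟨-phi D v w, 0, by rw [neg_smul, zero_smul, add_zero];
                               exact (eq_neg_of_add_eq_zero_left h0).symm⟩
    obtain ⟨s, hs, hm⟩ := key _ (h.phi_bdry hn w) hb'
    have he' : e = phi D v (-e) • v := by
      rw [neg_add_eq_zero] at hb; exact hb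
    have h1 := (h.mem_iff hn _).1 hm
    have h2 : s • (w + phi D v w • v) - e =
      s • (w + phi D v w • v) + (-phi D v (-e)) • v := by
      conv_lhs => rw [he']
      module
    rw [h2, h.phi_shift hn, h.phi_smul hn _ hs, h.phi_bdry hn] at h1
    linarith
  · obtain ⟨s, hs, hm⟩ := key _ (h.phi_bdry hn (-e)) hb
    set b := -e + phi D v (-e) • v with hbdef
    have h1 := (h.mem_iff hn _).1 hm
    have h2 : (1 + s) • b = (s • b - e) + phi D v (-e) • v := by
      rw [add_smul, one_smul]
      conv_lhs => enter [1]; rw [hbdef]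
      module
    have h3 : phi D v ((1 + s) • b) = 0 := by
      rw [h.phi_smul hn _ (by linarith), h.phi_bdry hn, mul_zero]
    rw [h2, h.phi_shift hn] at h3
    linarith

lemma sphere_part {n : ℕ} (hn : 3 ≤ n) {D : Set (Euc n)} {v : Euc n} (h : GoodCone D v)
    (x : Euc n) (M : Set (Euc n))
    (hM : ∀ z, z ∈ M ↔ phi D v (z - x) = 0 ∧ phi D v (-(z - x)) = 1) :
    IsSphereEmbeddingImage (n - 2) M := by
  have hfact : Fact (Module.finrank ℝ (Euc n) = (n - 2 + 1) + 1) :=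
    ⟨by rw [finrank_euclideanSpace, Fintype.card_fin]; omega⟩
  have hv := h.v_ne hn
  let e := (OrthonormalBasis.fromOrthogonalSpanSingleton (𝕜 := ℝ) (n - 2 + 1) hv).repr.symm
  let ψ : Euc n → ℝ := fun w => phi D v w + phi D v (-w)
  let ι : Metric.sphere (0 : Euc (n - 2 + 1)) 1 → Euc n := fun u => (e u.1 : Euc n)
  have hιc : Continuous ι := by
    exact continuous_subtype_val.comp (e.continuous.comp continuous_subtype_val)
  have hιn : ∀ u, ‖ι u‖ = 1 := by
    intro u
    have : ‖(e u.1 : Euc n)‖ = ‖u.1‖ := e.norm_map u.1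
    rw [show ι u = (e u.1 : Euc n) from rfl, this]
    simpa using u.2
  have horth : ∀ u, inner ℝ v (ι u) = 0 := fun u =>
    Submodule.mem_orthogonal_singleton_iff_inner_right.1 (e u.1).2
  have hψ : ∀ u, 0 < ψ (ι u) := by
    intro u
    apply h.phi_sum_pos hn
    intro hs
    obtain ⟨c, hc⟩ := Submodule.mem_span_singleton.1 hs
    have h1 := horth u
    rw [← hc, inner_smul_right, real_inner_self_eq_norm_sq] at h1
    have h2 : ‖v‖ ^ 2 ≠ 0 := by positivity
    have : c = 0 := by simpa [h2] using h1
    have h3 := hιn u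
    rw [← hc, this, zero_smul, norm_zero] at h3
    exact zero_ne_one h3
  have hφc := h.phi_cont hn
  have hψc : Continuous ψ := hφc.add (hφc.comp continuous_neg)
  refine ⟨fun u => x + (ψ (ι u))⁻¹ • (ι u + phi D v (ι u) • v), ?_, ?_, ?_⟩
  · have : Continuous fun u => (ψ (ι u))⁻¹ := (hψc.comp hιc).inv₀ fun u => (hψ u).ne'
    have : Continuous fun u => phi D v (ι u) := hφc.comp hιc
    fun_prop
  · intro u u' huu
    simp only [add_right_inj] at huu
    -- split into the `v`-component and the orthogonal one
    have key : ∀ (c c' a a' : ℝ), c • (ι u + a • v) = c' • (ι u' + a' • v) →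
        c • ι u = c' • ι u' := by
      intro c c' a a' hh
      have h1 := congrArg (fun w => (inner ℝ v w : ℝ)) hh
      simp only [inner_smul_right, inner_add_right, horth, zero_add,
        real_inner_self_eq_norm_sq] at h1
      have h2 : ‖v‖ ^ 2 ≠ 0 := by positivity
      have h3 : c * a = c' * a' := by
        apply mul_right_cancel₀ h2; linarith
      rw [smul_add, smul_add, smul_smul, smul_smul, h3] at hh
      exact add_right_cancel hh
    have h1 := key _ _ _ _ huu
    have h2 := congrArg norm h1
    rw [norm_smul, norm_smul, hιn, hιn, mul_one, mul_one,
      Real.norm_of_nonneg (inv_pos.2 (hψ u)).le, Real.norm_of_nonneg (inv_pos.2 (hψ u')).le] at h2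
    rw [h2] at h1
    have h3 : ι u = ι u' := smul_right_injective _ (inv_pos.2 (hψ u')).ne' h1
    exact Subtype.ext (e.injective (Subtype.ext h3))
  · ext z
    rw [hM]
    constructor
    · rintro ⟨u, rfl⟩
      have hp := inv_pos.2 (hψ u)
      dsimp only
      rw [add_sub_cancel_left]
      refine ⟨by rw [h.phi_smul hn _ hp.le, h.phi_bdry hn, mul_zero], ?_⟩
      have : -((ψ (ι u))⁻¹ • (ι u + phi D v (ι u) • v)) =
        (ψ (ι u))⁻¹ • (-ι u + (-phi D v (ι u)) • v) := by module
      rw [this, h.phi_smul hn _ hp.le, h.phi_shift hn]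
      have : phi D v (-ι u) - -phi D v (ι u) = ψ (ι u) := by simp only [ψ]; ring
      rw [this, inv_mul_cancel₀ (hψ u).ne']
    · rintro ⟨hz1, hz2⟩
      obtain ⟨a, ha, w, hw, hzw⟩ := (Submodule.span ℝ {v}).exists_add_mem_mem_orthogonal (z - x)
      obtain ⟨c, rfl⟩ := Submodule.mem_span_singleton.1 ha
      have hzw' : z - x = w + c • v := by rw [hzw, add_comm]
      have hzn : -(z - x) = -w + (-c) • v := by rw [hzw']; module
      rw [hzn, h.phi_shift hn] at hz2
      rw [hzw', h.phi_shift hn] at hz1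
      have hcw : c = phi D v w := by linarith
      have hw0 : w ≠ 0 := by
        rintro rfl
        rw [neg_zero, h.phi_zero hn] at *
        linarith
      have hwn : 0 < ‖w‖ := norm_pos_iff.2 hw0
      let u : Metric.sphere (0 : Euc (n - 2 + 1)) 1 := ⟨e.symm (‖w‖⁻¹ • ⟨w, hw⟩), by
        rw [mem_sphere_zero_iff_norm, e.symm.norm_map, norm_smul, norm_inv, norm_norm]
        exact inv_mul_cancel₀ hwn.ne'⟩
      have hu : ι u = ‖w‖⁻¹ • w := by
        simp only [ι, u, LinearIsometryEquiv.apply_symm_apply]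
        rfl
      refine ⟨u, ?_⟩
      have hwi := (inv_pos.2 hwn).le
      have e1 : phi D v (ι u) = ‖w‖⁻¹ * phi D v w := by rw [hu, h.phi_smul hn _ hwi]
      have e2 : ψ (ι u) = ‖w‖⁻¹ := by
        simp only [ψ]
        rw [hu, ← smul_neg, h.phi_smul hn _ hwi, h.phi_smul hn _ hwi, ← mul_add]
        rw [show phi D v w + phi D v (-w) = 1 by linarith, mul_one]
      dsimp only
      rw [e1, e2, hu, mul_smul, ← smul_add, smul_smul, inv_inv, mul_inv_cancel₀ hwn.ne', one_smul,
        ← hcw, ← hzw']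
      abel

/-- In the Setting, for every `x ∈ L` and `y ∈ L` with `y ≠ x`
such that `C_y` is a translate of `C_x`, the set `Λ = C_x ∩ C_y` is the image
of a topological embedding of the sphere `S^(n-2)`. -/
theorem stmt_4 (n : ℕ) (hn : 3 ≤ n) (K L : Set (Euc n))
    (hK : IsConvexBody K) (hKs : StrictConvex ℝ K)
    (hL : IsSphereEmbeddingImage (n - 1) L)
    (hcomp : ∃ z ∈ Lᶜ, Bornology.IsBounded (connectedComponentIn Lᶜ z) ∧
      K ⊆ connectedComponentIn Lᶜ z)
    (hcone : ∀ x ∈ L, ∃ y ∈ L, y ≠ x ∧ ∃ p : Euc n,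
      supportCone K y = (fun z => p + z) '' supportCone K x) :
    ∀ x ∈ L, ∀ y ∈ L, y ≠ x →
      (∃ p : Euc n, supportCone K y = (fun z => p + z) '' supportCone K x) →
      IsSphereEmbeddingImage (n - 2) (supportCone K x ∩ supportCone K y) := by
  intro x hx y hy hxy ⟨p, hp⟩
  obtain ⟨z₀, -, -, hKc⟩ := hcomp
  have hKL : ∀ z ∈ L, z ∉ K := fun z hz hzK => connectedComponentIn_subset _ _ (hKc hzK) hz
  obtain ⟨k₀, hk₀⟩ := hK.2.2
  have gx := kcone_good hK (hKL x hx) hk₀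
  have gy := kcone_good hK (hKL y hy) hk₀
  have H : ∀ z, z ∈ GoodCone.bd (kcone K y) (k₀ - y) ↔
      z - (p + x - y) ∈ GoodCone.bd (kcone K x) (k₀ - x) := by
    intro z
    have h1 := mem_supportCone hn gy (z + y)
    rw [add_sub_cancel_right] at h1
    have h2 := mem_supportCone hn gx (z + y - p)
    rw [← h1, hp, show z - (p + x - y) = z + y - p - x by abel, ← h2]
    constructor
    · rintro ⟨w, hw, hwz⟩
      have : z + y - p = w := by rw [← hwz]; simp
      rwa [this]
    · intro hw
      exact ⟨_, hw, by simp⟩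
  have hq := gx.apex gy hn H
  have hbd : GoodCone.bd (kcone K x) (k₀ - x) = GoodCone.bd (kcone K y) (k₀ - y) := by
    ext z; rw [H, hq, sub_zero]
  rcases gx.eq_or_neg gy hn hbd with heq | heq
  · exfalso
    have h1 := same_cone_aux hn gx heq
    have g2 : GoodCone (kcone K y) (k₀ - x) := heq ▸ gx
    have h2 := same_cone_aux hn g2 heq.symm
    rw [← heq, neg_sub] at h2
    have := gx.eq_zero_of_phi hn h2 h1
    exact hxy (sub_eq_zero.1 this)
  · -- opposite cones
    have hyk : y - k₀ ∈ kcone K x := by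
      have : k₀ - y ∈ kcone K y := ⟨1, zero_le_one, k₀, interior_subset hk₀, by simp⟩
      rw [heq] at this
      have h3 : -(k₀ - y) ∈ kcone K x := this
      rwa [neg_sub] at h3
    have hint : y - x ∈ interior (kcone K x) := by
      have h1 : y - x ∈ (Homeomorph.addRight (y - k₀)) '' interior (kcone K x) :=
        ⟨k₀ - x, gx.int, by simp⟩
      rw [Homeomorph.image_interior] at h1
      refine interior_mono ?_ h1
      rintro _ ⟨d, hd, rfl⟩
      exact gx.add _ hd _ hyk
    have g : GoodCone (kcone K x) (y - x) := ⟨gx.closed, gx.add, gx.smul, gx.pointed, hint⟩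
    apply sphere_part hn g x
    intro z
    have hyc : z ∈ supportCone K y ↔ z - y ∈ GoodCone.bd (kcone K x) (y - x) := by
      rw [mem_supportCone hn gy, ← hbd]
      have h1 := mem_supportCone hn gx (z - y + x)
      have h2 := mem_supportCone hn g (z - y + x)
      rw [add_sub_cancel_right] at h1 h2
      rw [← h1, h2]
    rw [mem_inter_iff, mem_supportCone hn g, hyc]
    have e1 : z - y = (z - x) + (-1 : ℝ) • (y - x) := by module
    have e2 : -(z - y) = -(z - x) + (1 : ℝ) • (y - x) := by module
    have hsub := g.phi_add hn (z - x) (-(z - x))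
    rw [add_neg_cancel, g.phi_zero hn] at hsub
    simp only [GoodCone.bd, mem_ofPred_eq]
    rw [e2, e1, g.phi_shift hn, g.phi_shift hn]
    constructor
    · rintro ⟨h1 | h1, h2 | h2⟩
      · linarith
      · exact ⟨h1, by linarith⟩
      · linarith
      · linarith
    · rintro ⟨h1, h2⟩
      exact ⟨Or.inl h1, Or.inr (by linarith)⟩
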